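/- The sequence (a_j) consists of nonzero elements of K, and setting d_j := a_j^{-1}: (1) d₂ = D₂, i.e. a₂·D₂ = 1; (2) for every k ≥ 3, d_k·(d_{k-1} + D_k) = D_k·d_{k-1}·(1 + D_k + D_{k-1}² + D_{k-2}⁴ + ⋯ + D₂^{2^{k-2}}) — equivalently, 1 + D_k·a_{k-1} = a_k·D_k·(1 + Σ_{j=2}^{k} D_j^{2^{k-j}}). This expresses the exponential denominators d_k recursively in terms of the products D_i of all monic elements of A of degree i. -/

import Mathlib

noncomputable section

open Polynomial
open scoped Classical

/-- The defining polynomial `Y² + Y + (X³ + X + 1)` over `𝔽₂[X]`,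
viewed as a polynomial in `Y` with coefficients in `𝔽₂[X]`. -/
def curveEq : Polynomial (Polynomial (ZMod 2)) :=
  X ^ 2 + X + C (X ^ 3 + X + 1)

/-- The ring `A = 𝔽₂[X,Y]/(Y² + Y + X³ + X + 1)`. -/
abbrev A : Type := AdjoinRoot curveEq

/-- The image `x` of `X` in `A`. -/
def aX : A := AdjoinRoot.of curveEq (X : Polynomial (ZMod 2))

/-- The image `y` of `Y` in `A`. -/
def aY : A := AdjoinRoot.root curveEq

/-- The bracket `[j]_x = x^{2^j} + x ∈ A`. -/
def brX (j : ℕ) : A := aX ^ 2 ^ j + aX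

/-- The monomials `xⁱyʲ` with `j ∈ {0,1}` and `2i + 3j < k`. -/
def monoSet (k : ℕ) : Finset A :=
  ((Finset.range k ×ˢ Finset.range 2).filter fun p => 2 * p.1 + 3 * p.2 < k).image
    fun p => aX ^ p.1 * aY ^ p.2

/-- `A_{<k}` : the `𝔽₂`-linear span of the monomials `xⁱyʲ` with `j ∈ {0,1}`
and `2i + 3j < k`, realized as the finite set of all subset sums. -/
def Alt (k : ℕ) : Finset A := (monoSet k).powerset.image fun s => s.sum id

/-- `t_k := x^{k/2}` if `k` is even, `t_k := y·x^{(k-3)/2}` if `k` is odd. -/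
def tk (k : ℕ) : A := if Even k then aX ^ (k / 2) else aY * aX ^ ((k - 3) / 2)

/-- `e_k(w) := ∏_{a ∈ A_{<k}} (w + a) ∈ A[w]`. -/
def ePoly (k : ℕ) : Polynomial A := ∏ a ∈ Alt k, (X + C a)

/-- `D_k := e_k(t_k)`, the product of all monic elements of `A` of degree `k`. -/
def Dk (k : ℕ) : A := (ePoly k).eval (tk k)

variable (K : Type) [Field K] [Algebra A K]

/-- The coefficients `a_j = 1/d_j` of the exponential function:
`a₀ = a₁ = 1` and `a_j = ([1]_x·a_{j-1}² + a_{j-2}⁴)/[j]_x` for `j ≥ 2`. -/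
def aSeq : ℕ → K
  | 0 => 1
  | 1 => 1
  | (j + 2) =>
      (algebraMap A K (brX 1) * (aSeq (j + 1)) ^ 2 + (aSeq j) ^ 4) /
        algebraMap A K (brX (j + 2))

/-- The coefficients `b_j = 1/ℓ_j` of the logarithm function:
`b₀ = b₁ = 1` and `b_j = ([1]_x^{2^{j-1}}·b_{j-1} + b_{j-2})/[j]_x` for `j ≥ 2`. -/
def bSeq : ℕ → K
  | 0 => 1
  | 1 => 1
  | (j + 2) =>
      (algebraMap A K (brX 1) ^ 2 ^ (j + 1) * bSeq (j + 1) + bSeq j) /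
        algebraMap A K (brX (j + 2))

/-- `p_k(w) := Σ_{j=0}^{k} a_j·b_{k-j}^{2^j}·w^{2^j} ∈ K[w]`. -/
def pPoly (k : ℕ) : Polynomial K :=
  ∑ j ∈ Finset.range (k + 1), C (aSeq K j * (bSeq K (k - j)) ^ 2 ^ j) * X ^ 2 ^ j

/-- `S_{n,r}(x₁,…,x_n) := Σ_{n ≥ i₁ > i₂ > … > i_r ≥ 1} ∏_{j=1}^{r}
x_{i_j}^{2^{n-j+1-i_j}}`, with `S_{n,0} = 1` and `S_{n,r} = 0` for `r > n`. -/
def Ssum (R : Type*) [CommRing R] (n r : ℕ) (x : ℕ → R) : R :=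
  ∑ f ∈ Finset.univ.filter
      (fun f : Fin r → Fin (n + 1) => StrictAnti f ∧ ∀ j, 1 ≤ (f j : ℕ)),
    ∏ j : Fin r, x (f j) ^ 2 ^ (n - (j : ℕ) - (f j : ℕ))

variable {K}

section TwistedSeries

variable {F : Type} [Field F]

/-- Left multiplication by the Frobenius `τ` on twisted power series `∑ uₙ τⁿ`. -/
def frobShift (u : ℕ → F) : ℕ → F
  | 0 => 0
  | n + 1 => u n ^ 2

/-- Right multiplication by the constant `w` on twisted power series. -/
def twistScale (u : ℕ → F) (w : F) : ℕ → F := fun n => u n * w ^ 2 ^ n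

/-- The product of twisted power series. -/
def twistMul (u v : ℕ → F) : ℕ → F :=
  fun k => ∑ i ∈ Finset.range (k + 1), u i * v (k - i) ^ 2 ^ i

/-- The right inverse of a twisted power series with constant coefficient `1`, in characteristic
two. -/
def twistInv (u : ℕ → F) : ℕ → F
  | 0 => 1
  | k + 1 => ∑ i : Fin (k + 1), u (i + 1) * twistInv u (k - i) ^ 2 ^ ((i : ℕ) + 1)
decreasing_by omega

/-- The series is a polynomial in `τ`, monic of degree `n`. -/
def TwistMonic (u : ℕ → F) (n : ℕ) : Prop := u n = 1 ∧ ∀ k, n < k → u k = 0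

lemma frobShift_twistScale (u : ℕ → F) (w : F) :
    frobShift (twistScale u w) = twistScale (frobShift u) w := by
  funext n
  cases n with
  | zero => simp [frobShift, twistScale]
  | succ n => simp only [frobShift, twistScale]; ring

lemma twistScale_mul (u : ℕ → F) (v w : F) :
    twistScale u (v * w) = twistScale (twistScale u v) w := by
  funext n
  simp only [twistScale, mul_pow]; ring

lemma TwistMonic.frobShift {u : ℕ → F} {n : ℕ} (h : TwistMonic u n) :
    TwistMonic (frobShift u) (n + 1) := by
  refine ⟨by simp [_root_.frobShift, h.1], fun k hk => ?_⟩
  obtain ⟨k, rfl⟩ : ∃ m, k = m + 1 := ⟨k - 1, by omega⟩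
  simp [_root_.frobShift, h.2 k (by omega)]

lemma add_twistScale (u v : ℕ → F) (w : F) :
    twistScale (u + v) w = twistScale u w + twistScale v w := by
  funext n
  simp [twistScale, add_mul]

lemma smul_twistScale (c : F) (u : ℕ → F) (w : F) :
    twistScale (c • u) w = c • twistScale u w := by
  funext n
  simp [twistScale, mul_assoc]

lemma frobShift_smul (c : F) (u : ℕ → F) : frobShift (c • u) = c ^ 2 • frobShift u := by
  funext n
  cases n with
  | zero => simp [frobShift]
  | succ n => simp [frobShift, mul_pow]

lemma add_twistMul (u v w : ℕ → F) : twistMul (u + v) w = twistMul u w + twistMul v w := by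
  funext n
  simp [twistMul, add_mul, Finset.sum_add_distrib]

lemma smul_twistMul (c : F) (u v : ℕ → F) : twistMul (c • u) v = c • twistMul u v := by
  funext n
  simp [twistMul, Finset.mul_sum, mul_assoc]

variable [CharP F 2]

lemma frobShift_add (u v : ℕ → F) : frobShift (u + v) = frobShift u + frobShift v := by
  funext n
  cases n with
  | zero => simp [frobShift]
  | succ n => simp [frobShift, CharTwo.add_sq]

lemma frobShift_twistMul (u v : ℕ → F) :
    frobShift (twistMul u v) = twistMul (frobShift u) v := by
  funext n
  cases n with
  | zero => simp [frobShift, twistMul]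
  | succ n =>
    simp only [frobShift, twistMul]
    rw [Finset.sum_range_succ' _ (n + 1), CharTwo.sum_sq]
    simp only [Nat.add_sub_add_right, zero_mul, add_zero]
    exact Finset.sum_congr rfl fun i _ => by ring

lemma twistScale_add (u : ℕ → F) (v w : F) :
    twistScale u (v + w) = twistScale u v + twistScale u w := by
  funext n
  simp [twistScale, add_pow_char_pow, mul_add]

lemma twistMul_twistInv (u : ℕ → F) (hu : u 0 = 1) :
    TwistMonic (twistMul u (twistInv u)) 0 := by
  refine ⟨by simp [twistMul, twistInv, hu], fun k hk => ?_⟩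
  obtain ⟨k, rfl⟩ : ∃ m, k = m + 1 := ⟨k - 1, by omega⟩
  rw [twistMul, Finset.sum_range_succ']
  simp only [hu, Nat.sub_zero, pow_zero, pow_one, one_mul, Nat.add_sub_add_right]
  rw [twistInv, ← Fin.sum_univ_eq_sum_range
    (fun i => u (i + 1) * twistInv u (k - i) ^ 2 ^ (i + 1)), CharTwo.add_self_eq_zero]

/-- The scalar identity behind the commutation of `x + (x² + x)τ + τ²` with
`y + (y² + y)τ + x(y² + y)τ² + τ³`. -/
lemma commutation_identity {x y X u0 u1 u2 u3 u4 u5 p q r : F}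
    (hxy : y ^ 2 + y = x ^ 3 + x + 1)
    (e0 : u0 * X = x * u0 + (x ^ 2 + x) * u1 + u2)
    (e1 : u1 * X = x ^ 2 * u1 + (x ^ 2 + x) ^ 2 * u2 + u3)
    (e2 : u2 * X = (x ^ 2) ^ 2 * u2 + ((x ^ 2 + x) ^ 2) ^ 2 * u3 + u4)
    (e3 : u3 * X = ((x ^ 2) ^ 2) ^ 2 * u3 + (((x ^ 2 + x) ^ 2) ^ 2) ^ 2 * u4 + u5)
    (e7 : p * X = x * p + (x ^ 2 + x) * q + r) :
    (X + x) * (p + (y * u0 + (y ^ 2 + y) * u1 + x * (y ^ 2 + y) * u2 + u3)) =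
      (x ^ 2 + x) *
        (q + (y ^ 2 * u1 + (y ^ 2 + y) ^ 2 * u2 + (x * (y ^ 2 + y)) ^ 2 * u3 + u4)) +
      (r + ((y ^ 2) ^ 2 * u2 + ((y ^ 2 + y) ^ 2) ^ 2 * u3
        + ((x * (y ^ 2 + y)) ^ 2) ^ 2 * u4 + u5)) := by
  have hy2 : y ^ 2 = y + (x ^ 3 + x + 1) := by
    linear_combination hxy - y * CharTwo.two_eq_zero (R := F)
  have hy4 : (y ^ 2) ^ 2 = y + (x ^ 3 + x + 1) + (x ^ 3 + x + 1) ^ 2 := by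
    rw [hy2, CharTwo.add_sq, hy2]
  rw [← CharTwo.add_eq_zero, hy4, hxy, hy2]
  linear_combination (norm := skip)
    e7 + y * e0 + (x ^ 3 + x + 1) * e1 + x * (x ^ 3 + x + 1) * e2 + e3
  grind

/-- If `u` intertwines `x` with a series whose constant coefficient is `x`, then it also
intertwines `y` with the corresponding commuting series. -/
lemma twistScale_root {x y : F} (hxy : y ^ 2 + y = x ^ 3 + x + 1)
    (hx : ∀ j, 1 ≤ j → x ^ 2 ^ j + x ≠ 0) {u : ℕ → F}
    (hu : twistScale u x = x • u + (x ^ 2 + x) • frobShift u + frobShift (frobShift u)) :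
    twistScale u y = y • u + (y ^ 2 + y) • frobShift u
      + (x * (y ^ 2 + y)) • frobShift (frobShift u)
      + frobShift (frobShift (frobShift u)) := by
  set d : ℕ → F := twistScale u y + (y • u + (y ^ 2 + y) • frobShift u
      + (x * (y ^ 2 + y)) • frobShift (frobShift u)
      + frobShift (frobShift (frobShift u))) with hd
  suffices h : d = 0 by
    funext n
    exact CharTwo.add_eq_zero.mp (congrFun h n)
  have hS := congrArg frobShift hu
  have hSS := congrArg frobShift hS
  have hSSS := congrArg frobShift hSS
  have hdS := congrArg frobShift hd
  have hdSS := congrArg frobShift hdS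
  have huy : twistScale (twistScale u y) x = x • twistScale u y
      + (x ^ 2 + x) • frobShift (twistScale u y) + frobShift (frobShift (twistScale u y)) := by
    rw [← twistScale_mul, mul_comm, twistScale_mul, hu]
    simp only [frobShift_twistScale]
    funext n
    simp only [twistScale, Pi.add_apply, Pi.smul_apply, smul_eq_mul]
    ring
  simp only [frobShift_twistScale, frobShift_add, frobShift_smul] at hS hSS hSSS hdS hdSS huy
  have key : ∀ n, (x ^ 2 ^ n + x) * d n
      = (x ^ 2 + x) * frobShift d n + frobShift (frobShift d) n := by
    intro n
    have e0 := congrFun hu n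
    have e1 := congrFun hS n
    have e2 := congrFun hSS n
    have e3 := congrFun hSSS n
    have e4 := congrFun hd n
    have e5 := congrFun hdS n
    have e6 := congrFun hdSS n
    have e7 := congrFun huy n
    simp only [twistScale, Pi.add_apply, Pi.smul_apply, smul_eq_mul] at e0 e1 e2 e3 e4 e5 e6 e7
    rw [e4, e5, e6]
    exact commutation_identity hxy e0 e1 e2 e3 e7
  funext n
  induction n using Nat.strong_induction_on with
  | _ n ih =>
    rcases n with _ | _ | n
    · simp [hd, twistScale, frobShift, mul_comm, CharTwo.add_self_eq_zero]
    · have h := key 1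
      have h0 := ih 0 (by omega)
      simp only [frobShift, h0, Pi.zero_apply] at h
      exact (mul_eq_zero.mp (by simpa using h)).resolve_left (hx 1 le_rfl)
    · have h := key (n + 2)
      have h0 := ih n (by omega)
      have h1 := ih (n + 1) (by omega)
      simp only [frobShift, h0, h1, Pi.zero_apply] at h
      exact (mul_eq_zero.mp (by simpa using h)).resolve_left (hx (n + 2) (by omega))

end TwistedSeries

section CoordinateRing

lemma curveEq_degree : curveEq.degree = 2 := by
  rw [curveEq]
  compute_degree!

instance : Nontrivial A := AdjoinRoot.nontrivial curveEq (by simp [curveEq_degree])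

instance : CharP A 2 := by
  refine CharTwo.of_one_ne_zero_of_two_eq_zero one_ne_zero ?_
  have h2 : (C 2 : (ZMod 2)[X]) = 0 := by
    rw [show (2 : ZMod 2) = 0 from rfl, C_0]
  exact (map_ofNat ((AdjoinRoot.of curveEq).comp C) 2).symm.trans (by simp [h2])

lemma curve_equation : aY ^ 2 + aY = aX ^ 3 + aX + 1 := by
  rw [← CharTwo.add_eq_zero]
  have h : eval₂ (AdjoinRoot.of curveEq) (AdjoinRoot.root curveEq)
      (X ^ 2 + X + C (X ^ 3 + X + 1)) = 0 := AdjoinRoot.eval₂_root curveEq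
  simp only [eval₂_add, eval₂_pow, eval₂_X, eval₂_C, eval₂_one, map_add, map_pow, map_one] at h
  exact h

end CoordinateRing

section Coefficients

/-- The embedding of `𝔽₂[X]` in `K`. -/
def polyMap : (ZMod 2)[X] →+* K := (algebraMap A K).comp (AdjoinRoot.of curveEq)

lemma polyMap_bracket (j : ℕ) :
    polyMap (X ^ 2 ^ j + X : (ZMod 2)[X]) = algebraMap A K (brX j) := by
  simp [polyMap, brX, aX]

lemma bracket_natDegree {j : ℕ} (hj : 1 ≤ j) :
    (X ^ 2 ^ j + X : (ZMod 2)[X]).natDegree = 2 ^ j := by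
  have h : 1 < 2 ^ j := Nat.one_lt_two_pow (by omega)
  rw [natDegree_add_eq_left_of_natDegree_lt] <;> simp [h]

lemma bracket_monic {j : ℕ} (hj : 1 ≤ j) : (X ^ 2 ^ j + X : (ZMod 2)[X]).Monic := by
  have h : 1 < 2 ^ j := Nat.one_lt_two_pow (by omega)
  exact monic_X_pow_add (by simpa using by exact_mod_cast h)

variable (K) in
/-- The coefficients in `τ` of the Drinfeld module at `w`: the series `e w e⁻¹`, where
`e = ∑ a_j τ^j`. -/
def drinfeld (w : K) : ℕ → K := twistMul (twistScale (aSeq K) w) (twistInv (aSeq K))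

lemma drinfeld_zero : drinfeld K 0 = 0 := by
  funext n
  simp [drinfeld, twistMul, twistScale]

lemma drinfeld_add [CharP K 2] (v w : K) : drinfeld K (v + w) = drinfeld K v + drinfeld K w := by
  rw [drinfeld, twistScale_add, add_twistMul]; rfl

lemma drinfeld_one [CharP K 2] : TwistMonic (drinfeld K 1) 0 := by
  have : twistScale (aSeq K) 1 = aSeq K := by funext n; simp [twistScale]
  rw [drinfeld, this]
  exact twistMul_twistInv _ (by simp [aSeq])

variable [IsFractionRing A K]

variable (K) in
lemma algebraMap_inj : Function.Injective (algebraMap A K) := IsFractionRing.injective A K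

variable (K) in
lemma charP_fractionField : CharP K 2 := charP_of_injective_algebraMap (algebraMap_inj K) 2

lemma polyMap_injective : Function.Injective (polyMap (K := K)) :=
  (algebraMap_inj K).comp (AdjoinRoot.of.injective_of_degree_ne_zero (by simp [curveEq_degree]))

lemma algebraMap_brX_ne_zero {j : ℕ} (hj : 1 ≤ j) : algebraMap A K (brX j) ≠ 0 := by
  rw [← polyMap_bracket, ← map_zero (polyMap (K := K))]
  exact polyMap_injective.ne (bracket_monic hj).ne_zero

/-- The numerators of the coefficients `a_j` over the denominators `∏ [i]^{2^{j-i}}`. -/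
def aNum : ℕ → (ZMod 2)[X]
  | 0 => 1
  | 1 => X ^ 2 ^ 1 + X
  | j + 2 => (X ^ 2 ^ 1 + X) * aNum (j + 1) ^ 2 + (X ^ 2 ^ (j + 1) + X) ^ 2 * aNum j ^ 4

/-- The denominators `∏ [i]^{2^{j-i}}`. -/
def aDen : ℕ → (ZMod 2)[X]
  | 0 => 1
  | j + 1 => (X ^ 2 ^ (j + 1) + X) * aDen j ^ 2

lemma aNum_monic_natDegree (j : ℕ) :
    ((aNum (j + 1)).Monic ∧ (aNum (j + 1)).natDegree = (j + 2) * 2 ^ j) ∧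
    ((aNum (j + 2)).Monic ∧ (aNum (j + 2)).natDegree = (j + 3) * 2 ^ (j + 1)) := by
  have b1 := bracket_monic (j := 1) le_rfl
  have d1 := bracket_natDegree (j := 1) le_rfl
  induction j with
  | zero =>
    refine ⟨⟨b1, by simpa [aNum] using d1⟩, ?_⟩
    have e : aNum 2 = (X ^ 2 ^ 1 + X) ^ 3 + (X ^ 2 ^ 1 + X) ^ 2 := by
      simp only [aNum]; ring
    have hlt : ((X ^ 2 ^ 1 + X : (ZMod 2)[X]) ^ 2).natDegree
        < ((X ^ 2 ^ 1 + X : (ZMod 2)[X]) ^ 3).natDegree := by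
      rw [b1.natDegree_pow, b1.natDegree_pow, d1]; norm_num
    rw [zero_add, e]
    refine ⟨(b1.pow 3).add_of_left (degree_lt_degree hlt), ?_⟩
    rw [natDegree_add_eq_left_of_natDegree_lt hlt, b1.natDegree_pow, d1]
  | succ j ih =>
    obtain ⟨⟨m1, n1⟩, m2, n2⟩ := ih
    refine ⟨⟨m2, n2⟩, ?_⟩
    have b := bracket_monic (j := j + 2) (by omega)
    have db := bracket_natDegree (j := j + 2) (by omega)
    have e : aNum (j + 1 + 2) = (X ^ 2 ^ 1 + X) * aNum (j + 2) ^ 2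
      + (X ^ 2 ^ (j + 2) + X) ^ 2 * aNum (j + 1) ^ 4 := rfl
    have dl : ((X ^ 2 ^ 1 + X) * aNum (j + 2) ^ 2).natDegree = 2 + (j + 3) * 2 ^ (j + 2) := by
      rw [b1.natDegree_mul (m2.pow 2), m2.natDegree_pow, d1, n2]; ring
    have dr : ((X ^ 2 ^ (j + 2) + X) ^ 2 * aNum (j + 1) ^ 4).natDegree
        = (j + 4) * 2 ^ (j + 2) := by
      rw [(b.pow 2).natDegree_mul (m1.pow 4), b.natDegree_pow, m1.natDegree_pow, db, n1]; ring
    have hlt : ((X ^ 2 ^ 1 + X) * aNum (j + 2) ^ 2).natDegree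
        < ((X ^ 2 ^ (j + 2) + X) ^ 2 * aNum (j + 1) ^ 4).natDegree := by
      rw [dl, dr]
      have : 0 < 2 ^ j := by positivity
      rw [pow_add]
      nlinarith
    rw [e]
    refine ⟨((b.pow 2).mul (m1.pow 4)).add_of_right (degree_lt_degree hlt), ?_⟩
    rw [natDegree_add_eq_right_of_natDegree_lt hlt, dr]

lemma aSeq_mul_aDen (j : ℕ) :
    aSeq K j * polyMap (aDen j) = polyMap (aNum j) ∧
    aSeq K (j + 1) * polyMap (aDen (j + 1)) = polyMap (aNum (j + 1)) := by
  induction j with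
  | zero => simp [aSeq, aDen, aNum]
  | succ j ih =>
    refine ⟨ih.2, ?_⟩
    have hb : algebraMap A K (brX (j + 2)) ≠ 0 := algebraMap_brX_ne_zero (by omega)
    have e1 : polyMap (aNum (j + 2)) = algebraMap A K (brX 1) * polyMap (aNum (j + 1)) ^ 2
        + algebraMap A K (brX (j + 1)) ^ 2 * polyMap (aNum j) ^ 4 := by
      simp only [← polyMap_bracket, aNum, map_add, map_mul, map_pow]
    have e2 : polyMap (aDen (j + 2))
        = algebraMap A K (brX (j + 2)) * polyMap (aDen (j + 1)) ^ 2 := by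
      simp only [← polyMap_bracket, aDen, map_add, map_mul, map_pow]
    have e3 : polyMap (aDen (j + 1)) = algebraMap A K (brX (j + 1)) * polyMap (aDen j) ^ 2 := by
      simp only [← polyMap_bracket, aDen, map_add, map_mul, map_pow]
    have e4 : aSeq K (j + 2) * algebraMap A K (brX (j + 2))
        = algebraMap A K (brX 1) * aSeq K (j + 1) ^ 2 + aSeq K j ^ 4 := by
      rw [aSeq, div_mul_cancel₀ _ hb]
    change aSeq K (j + 2) * polyMap (aDen (j + 2)) = polyMap (aNum (j + 2))
    rw [e1, e2, ← mul_assoc, e4, ← ih.1, ← ih.2, e3]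
    ring

lemma aSeq_ne_zero (j : ℕ) : aSeq K j ≠ 0 := by
  rcases j with _ | j
  · simp [aSeq]
  · intro h
    have h1 := (aSeq_mul_aDen (K := K) j).2
    rw [h, zero_mul, eq_comm, ← map_zero (polyMap (K := K))] at h1
    exact (aNum_monic_natDegree j).1.1.ne_zero (polyMap_injective h1)

lemma twistScale_aSeq [CharP K 2] :
    twistScale (aSeq K) (algebraMap A K aX) = algebraMap A K aX • aSeq K
      + (algebraMap A K aX ^ 2 + algebraMap A K aX) • frobShift (aSeq K)
      + frobShift (frobShift (aSeq K)) := by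
  funext j
  rcases j with _ | _ | j
  · simp [twistScale, frobShift, aSeq, Algebra.smul_def]
  · simp [twistScale, frobShift, aSeq, Algebra.smul_def]
    linear_combination - algebraMap A K aX * CharTwo.two_eq_zero (R := K)
  · have hb : algebraMap A K (brX (j + 2)) ≠ 0 := algebraMap_brX_ne_zero (by omega)
    have e4 : aSeq K (j + 2) * algebraMap A K (brX (j + 2))
        = algebraMap A K (brX 1) * aSeq K (j + 1) ^ 2 + aSeq K j ^ 4 := by
      rw [aSeq, div_mul_cancel₀ _ hb]
    simp only [brX, map_add, map_pow, pow_one] at e4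
    simp only [twistScale, frobShift, Pi.add_apply, Pi.smul_apply, smul_eq_mul]
    linear_combination e4
      - aSeq K (j + 2) * algebraMap A K aX * CharTwo.two_eq_zero (R := K)

variable [CharP K 2]

lemma drinfeld_aX_mul {w : K} {n : ℕ} (hw : TwistMonic (drinfeld K w) n) :
    TwistMonic (drinfeld K (algebraMap A K aX * w)) (n + 2) := by
  have e : drinfeld K (algebraMap A K aX * w) = algebraMap A K aX • drinfeld K w
      + (algebraMap A K aX ^ 2 + algebraMap A K aX) • frobShift (drinfeld K w)
      + frobShift (frobShift (drinfeld K w)) := by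
    simp only [drinfeld, twistScale_mul, twistScale_aSeq, frobShift_twistMul,
      frobShift_twistScale, add_twistScale, smul_twistScale, smul_twistMul, add_twistMul]
  have h1 := hw.frobShift
  have h2 := h1.frobShift
  rw [e]
  refine ⟨?_, fun k hk => ?_⟩
  · simp [hw.2 (n + 2) (by omega), h1.2 (n + 2) (by omega), h2.1]
  · simp [hw.2 k (by omega), h1.2 k (by omega), h2.2 k (by omega)]

lemma drinfeld_aY_mul {w : K} {n : ℕ} (hw : TwistMonic (drinfeld K w) n) :
    TwistMonic (drinfeld K (algebraMap A K aY * w)) (n + 3) := by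
  have hxy := congrArg (algebraMap A K) curve_equation
  simp only [map_add, map_pow, map_one] at hxy
  have hx : ∀ j, 1 ≤ j → algebraMap A K aX ^ 2 ^ j + algebraMap A K aX ≠ 0 := by
    intro j hj
    simpa [brX] using algebraMap_brX_ne_zero (K := K) hj
  have e := twistScale_root hxy hx (twistScale_aSeq (K := K))
  generalize algebraMap A K aX = x at e
  generalize algebraMap A K aY = y at e ⊢
  have e : drinfeld K (y * w) = y • drinfeld K w + (y ^ 2 + y) • frobShift (drinfeld K w)
      + (x * (y ^ 2 + y)) • frobShift (frobShift (drinfeld K w))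
      + frobShift (frobShift (frobShift (drinfeld K w))) := by
    simp only [drinfeld, twistScale_mul, e, frobShift_twistMul,
      frobShift_twistScale, add_twistScale, smul_twistScale, smul_twistMul, add_twistMul]
  have h1 := hw.frobShift
  have h2 := h1.frobShift
  have h3 := h2.frobShift
  rw [e]
  refine ⟨?_, fun k hk => ?_⟩
  · simp [hw.2 (n + 3) (by omega), h1.2 (n + 3) (by omega), h2.2 (n + 3) (by omega), h3.1]
  · simp [hw.2 k (by omega), h1.2 k (by omega), h2.2 k (by omega), h3.2 k (by omega)]

lemma drinfeld_monomial (i j : ℕ) :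
    TwistMonic (drinfeld K (algebraMap A K (aX ^ i * aY ^ j))) (2 * i + 3 * j) := by
  induction i with
  | zero =>
    induction j with
    | zero => simpa using drinfeld_one
    | succ j ih =>
      have h := drinfeld_aY_mul ih
      rwa [← map_mul, show aY * (aX ^ 0 * aY ^ j) = aX ^ 0 * aY ^ (j + 1) by ring] at h
  | succ i ih =>
    have h := drinfeld_aX_mul ih
    rwa [← map_mul, show aX * (aX ^ i * aY ^ j) = aX ^ (i + 1) * aY ^ j by ring,
      show 2 * i + 3 * j + 2 = 2 * (i + 1) + 3 * j by ring] at h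

lemma exists_tk_eq {k : ℕ} (hk : 2 ≤ k) :
    ∃ i j, j < 2 ∧ 2 * i + 3 * j = k ∧ tk k = aX ^ i * aY ^ j := by
  rw [tk]
  split_ifs with h
  · obtain ⟨m, rfl⟩ := h
    exact ⟨m, 0, by omega, by omega, by simp [← two_mul]⟩
  · obtain ⟨m, rfl⟩ := Nat.not_even_iff_odd.mp h
    exact ⟨m - 1, 1, by omega, by omega, by
      rw [show (2 * m + 1 - 3) / 2 = m - 1 by omega, pow_one, mul_comm]⟩

lemma drinfeld_tk {k : ℕ} (hk : 2 ≤ k) : drinfeld K (algebraMap A K (tk k)) k = 1 := by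
  obtain ⟨i, j, -, rfl, e⟩ := exists_tk_eq hk
  rw [e]
  exact (drinfeld_monomial i j).1

lemma drinfeld_eq_zero {k : ℕ} {a : A} (ha : a ∈ Alt k) :
    drinfeld K (algebraMap A K a) k = 0 := by
  obtain ⟨s, hs, rfl⟩ := Finset.mem_image.mp ha
  rw [Finset.mem_powerset] at hs
  clear ha
  induction s using Finset.induction_on with
  | empty => simp [drinfeld_zero]
  | insert m s hm ih =>
    rw [Finset.sum_insert hm, map_add, drinfeld_add, Pi.add_apply,
      ih fun _ h => hs (Finset.mem_insert_of_mem h), add_zero]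
    obtain ⟨p, hp, hpm⟩ := Finset.mem_image.mp (hs (Finset.mem_insert_self m s))
    rw [id, ← hpm]
    exact (drinfeld_monomial p.1 p.2).2 k (Finset.mem_filter.mp hp).2

end Coefficients

section Products

lemma mem_monoSet {k : ℕ} {m : A} :
    m ∈ monoSet k ↔ ∃ i j, j < 2 ∧ 2 * i + 3 * j < k ∧ aX ^ i * aY ^ j = m := by
  simp only [monoSet, Finset.mem_image, Finset.mem_filter, Finset.mem_product, Finset.mem_range,
    Prod.exists]
  constructor
  · rintro ⟨i, j, ⟨⟨-, hj⟩, h⟩, rfl⟩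
    exact ⟨i, j, hj, h, rfl⟩
  · rintro ⟨i, j, hj, h, rfl⟩
    exact ⟨i, j, ⟨⟨by omega, hj⟩, h⟩, rfl⟩

lemma monoSet_succ {k : ℕ} (hk : 2 ≤ k) : monoSet (k + 1) = insert (tk k) (monoSet k) := by
  obtain ⟨i', j', hj', hk', e⟩ := exists_tk_eq hk
  ext m
  rw [Finset.mem_insert, mem_monoSet, mem_monoSet, e]
  constructor
  · rintro ⟨i, j, hj, h, rfl⟩
    rcases Nat.lt_succ_iff_lt_or_eq.mp h with h | h
    · exact Or.inr ⟨i, j, hj, h, rfl⟩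
    · obtain rfl : j = j' := by omega
      obtain rfl : i = i' := by omega
      exact Or.inl rfl
  · rintro (rfl | ⟨i, j, hj, h, rfl⟩)
    · exact ⟨i', j', hj', by omega, rfl⟩
    · exact ⟨i, j, hj, by omega, rfl⟩

lemma monoSet_two : monoSet 2 = {1} := by
  ext m
  rw [mem_monoSet, Finset.mem_singleton]
  constructor
  · rintro ⟨i, j, -, h, rfl⟩
    obtain rfl : i = 0 := by omega
    obtain rfl : j = 0 := by omega
    simp
  · rintro rfl
    exact ⟨0, 0, by simp⟩

lemma Alt_two : Alt 2 = {0, 1} := by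
  rw [Alt, monoSet_two, ← Finset.insert_empty, Finset.powerset_insert]
  simp

lemma Alt_succ {k : ℕ} (hk : 2 ≤ k) (ht : tk k ∉ monoSet k) :
    Alt (k + 1) = Alt k ∪ (Alt k).image (tk k + ·) := by
  rw [Alt, monoSet_succ hk, Finset.powerset_insert, Finset.image_union, Finset.image_image, Alt,
    Finset.image_image]
  congr 1
  refine Finset.image_congr fun s hs => ?_
  have hs : s ⊆ monoSet k := by simpa using hs
  simp [Finset.sum_insert fun h => ht (hs h)]

lemma monoSet_subset_Alt (k : ℕ) : monoSet k ⊆ Alt k := fun m hm =>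
  Finset.mem_image.mpr ⟨{m}, by simpa using hm, by simp⟩

variable (K) in
lemma disjoint_Alt [IsFractionRing A K] {k : ℕ} (hk : 2 ≤ k) :
    Disjoint (Alt k) ((Alt k).image (tk k + ·)) := by
  have := charP_fractionField K
  rw [Finset.disjoint_right]
  intro a ha h
  obtain ⟨b, hb, rfl⟩ := Finset.mem_image.mp ha
  have h1 := drinfeld_eq_zero (K := K) h
  rw [map_add, drinfeld_add, Pi.add_apply, drinfeld_tk hk, drinfeld_eq_zero hb, add_zero] at h1
  exact one_ne_zero h1

variable (K) in
lemma tk_notMem_Alt [IsFractionRing A K] {k : ℕ} (hk : 2 ≤ k) : tk k ∉ Alt k := by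
  have := charP_fractionField K
  intro h
  exact one_ne_zero ((drinfeld_tk hk).symm.trans (drinfeld_eq_zero (K := K) h))

lemma ePoly_two : ePoly 2 = X ^ 2 + X := by
  rw [ePoly, Alt_two, Finset.prod_pair zero_ne_one]
  simp
  ring

/-- The subleading coefficient of `e_{n+2}`. -/
def eCoeff : ℕ → A
  | 0 => 1
  | n + 1 => eCoeff n ^ 2 + Dk (n + 2)

lemma eCoeff_succ (n : ℕ) :
    eCoeff (n + 1) = 1 + ∑ j ∈ Finset.Icc 2 (n + 2), Dk j ^ 2 ^ (n + 2 - j) := by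
  induction n with
  | zero => simp [eCoeff]
  | succ n ih =>
    rw [eCoeff, ih, CharTwo.add_sq, one_pow, CharTwo.sum_sq,
      Finset.sum_Icc_succ_top (by omega : 2 ≤ n + 1 + 2), add_assoc]
    congr 2
    · refine Finset.sum_congr rfl fun j hj => ?_
      have hj := (Finset.mem_Icc.mp hj).2
      rw [← pow_mul, ← pow_succ, show n + 1 + 2 - j = n + 2 - j + 1 by omega]
    · simp

variable (K) in
lemma card_Alt [IsFractionRing A K] (n : ℕ) : (Alt (n + 2)).card = 2 ^ (n + 1) := by
  induction n with
  | zero => simp [Alt_two]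
  | succ n ih =>
    have ht := tk_notMem_Alt K (k := n + 2) (by omega)
    rw [Alt_succ (by omega) fun h => ht (monoSet_subset_Alt _ h),
      Finset.card_union_of_disjoint (disjoint_Alt K (by omega)),
      Finset.card_image_of_injective _ (add_right_injective _), ih]
    ring

variable (K) in
lemma ePoly_succ_eq_mul_comp [IsFractionRing A K] {k : ℕ} (hk : 2 ≤ k) :
    ePoly (k + 1) = ePoly k * (ePoly k).comp (X + C (tk k)) := by
  have ht := tk_notMem_Alt K hk
  rw [ePoly, Alt_succ hk fun h => ht (monoSet_subset_Alt _ h),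
    Finset.prod_union (disjoint_Alt K hk),
    Finset.prod_image fun _ _ _ _ h => add_right_injective _ h, ePoly, prod_comp]
  simp [add_assoc]

variable (K) in
lemma ePoly_comp [IsFractionRing A K] (n : ℕ) (t : A) :
    (ePoly (n + 2)).comp (X + C t) = ePoly (n + 2) + C ((ePoly (n + 2)).eval t) := by
  induction n generalizing t with
  | zero =>
    simp [ePoly_two, CharTwo.add_sq]
    ring
  | succ n ih =>
    rw [ePoly_succ_eq_mul_comp K (by omega), ih]
    simp only [mul_comp, add_comp, ih, C_comp, eval_mul, eval_add, eval_C, C_mul, C_add]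
    linear_combination ePoly (n + 2) * C ((ePoly (n + 2)).eval t) * CharTwo.two_eq_zero (R := A[X])

variable (K) in
lemma ePoly_succ [IsFractionRing A K] (n : ℕ) :
    ePoly (n + 3) = ePoly (n + 2) ^ 2 + C (Dk (n + 2)) * ePoly (n + 2) := by
  rw [ePoly_succ_eq_mul_comp K (by omega), ePoly_comp K, Dk]
  ring

variable (K) in
lemma ePoly_eq [IsFractionRing A K] (n : ℕ) : ∃ r : A[X], r.natDegree < 2 ^ n ∧
    ePoly (n + 2) = X ^ 2 ^ (n + 1) + C (eCoeff n) * X ^ 2 ^ n + r := by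
  induction n with
  | zero => exact ⟨0, by simp, by simp [ePoly_two, eCoeff]⟩
  | succ n ih =>
    obtain ⟨r, hr, e⟩ := ih
    refine ⟨r ^ 2 + C (Dk (n + 2)) * (C (eCoeff n) * X ^ 2 ^ n + r), ?_, ?_⟩
    · have h1 : (r ^ 2).natDegree < 2 ^ (n + 1) := natDegree_pow_le.trans_lt (by rw [pow_succ]; omega)
      have h2 : (C (eCoeff n) * X ^ 2 ^ n + r).natDegree ≤ 2 ^ n :=
        natDegree_add_le_of_degree_le (natDegree_C_mul_X_pow_le _ _) hr.le
      have h3 : 2 ^ n < 2 ^ (n + 1) := Nat.pow_lt_pow_succ one_lt_two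
      exact (natDegree_add_le _ _).trans_lt
        (max_lt h1 ((natDegree_C_mul_le _ _).trans_lt (h2.trans_lt h3)))
    · rw [ePoly_succ K, e]
      simp only [CharTwo.add_sq, eCoeff, C_add, C_pow, mul_pow]
      ring

end Products

section Recursion

variable (K) in
/-- The polynomial whose values are the coefficients of `τ^k` in the Drinfeld module. -/
def coeffPoly (k : ℕ) : K[X] :=
  ∑ i ∈ Finset.range (k + 1), C (aSeq K i * twistInv (aSeq K) (k - i) ^ 2 ^ i) * X ^ 2 ^ i

lemma eval_coeffPoly (k : ℕ) (w : K) : (coeffPoly K k).eval w = drinfeld K w k := by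
  simp only [coeffPoly, eval_finsetSum, eval_mul, eval_C, eval_pow, eval_X, drinfeld, twistMul,
    twistScale]
  exact Finset.sum_congr rfl fun _ _ => by ring

lemma coeffPoly_eq (n : ℕ) : ∃ r : K[X], r.natDegree ≤ 2 ^ n ∧
    coeffPoly K (n + 2) =
      C (aSeq K (n + 2)) * X ^ 2 ^ (n + 2) + C (aSeq K (n + 1)) * X ^ 2 ^ (n + 1) + r := by
  refine ⟨∑ i ∈ Finset.range (n + 1),
    C (aSeq K i * twistInv (aSeq K) (n + 2 - i) ^ 2 ^ i) * X ^ 2 ^ i, ?_, ?_⟩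
  · refine natDegree_sum_le_of_forall_le _ _ fun i hi => (natDegree_C_mul_X_pow_le _ _).trans ?_
    exact Nat.pow_le_pow_right two_pos (Nat.lt_succ_iff.mp (Finset.mem_range.mp hi))
  · rw [coeffPoly, Finset.sum_range_succ, Finset.sum_range_succ]
    simp [twistInv, aSeq, show n + 2 - (n + 1) = 1 by omega]
    ring

variable [IsFractionRing A K]

lemma ePoly_eval_eq_zero {k : ℕ} {a : A} (ha : a ∈ Alt k) : (ePoly k).eval a = 0 := by
  rw [ePoly, eval_prod]
  exact Finset.prod_eq_zero ha (by simp [CharTwo.add_self_eq_zero])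

lemma coeffPoly_add_eq_zero (n : ℕ) :
    coeffPoly K (n + 2) + C (aSeq K (n + 2)) * (ePoly (n + 2)).map (algebraMap A K) ^ 2
      + C (aSeq K (n + 1) + aSeq K (n + 2) * algebraMap A K (eCoeff n) ^ 2)
        * (ePoly (n + 2)).map (algebraMap A K) = 0 := by
  have := charP_fractionField K
  refine eq_zero_of_degree_lt_of_eval_index_eq_zero (v := algebraMap A K) (Alt (n + 2))
    (algebraMap_inj K).injOn ?_ fun a ha => ?_
  · obtain ⟨p, hp, e⟩ := coeffPoly_eq (K := K) n
    obtain ⟨r, hr, e'⟩ := ePoly_eq K n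
    set s := algebraMap A K (eCoeff n)
    set α := aSeq K (n + 1) + aSeq K (n + 2) * s ^ 2 with hα
    set ρ := r.map (algebraMap A K)
    have hρ : ρ.natDegree < 2 ^ n := natDegree_map_le.trans_lt hr
    have eE : (ePoly (n + 2)).map (algebraMap A K)
        = X ^ 2 ^ (n + 1) + C s * X ^ 2 ^ n + ρ := by
      simp [e', s, ρ]
    have eq : coeffPoly K (n + 2) + C (aSeq K (n + 2)) * (X ^ 2 ^ (n + 1) + C s * X ^ 2 ^ n + ρ) ^ 2
        + C α * (X ^ 2 ^ (n + 1) + C s * X ^ 2 ^ n + ρ)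
        = p + C (aSeq K (n + 2)) * ρ ^ 2 + C α * (C s * X ^ 2 ^ n + ρ) := by
      rw [e, CharTwo.add_sq, CharTwo.add_sq, hα]
      simp only [C_add, C_mul, C_pow]
      linear_combination (C (aSeq K (n + 2)) * X ^ 2 ^ (n + 2) + C (aSeq K (n + 1)) * X ^ 2 ^ (n + 1)
        + C (aSeq K (n + 2)) * C s ^ 2 * X ^ 2 ^ (n + 1)) * CharTwo.two_eq_zero (R := K[X])
    have h3 : 2 ^ n < 2 ^ (n + 1) := Nat.pow_lt_pow_succ one_lt_two
    have h1 : (ρ ^ 2).natDegree < 2 ^ (n + 1) := natDegree_pow_le.trans_lt (by rw [pow_succ]; omega)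
    have h2 : (C s * X ^ 2 ^ n + ρ).natDegree ≤ 2 ^ n :=
      natDegree_add_le_of_degree_le (natDegree_C_mul_X_pow_le _ _) hρ.le
    rw [eE, eq, card_Alt K]
    refine degree_le_natDegree.trans_lt (Nat.cast_lt.mpr ?_)
    refine (natDegree_add_le _ _).trans_lt (max_lt ((natDegree_add_le _ _).trans_lt
      (max_lt (hp.trans_lt h3) ?_)) ?_)
    · exact (natDegree_C_mul_le _ _).trans_lt h1
    · exact (natDegree_C_mul_le _ _).trans_lt (h2.trans_lt h3)
  · simp [eval_coeffPoly, drinfeld_eq_zero ha, eval_map_algebraMap, aeval_algebraMap_apply,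
      ePoly_eval_eq_zero ha]

lemma one_add_Dk_mul_aSeq (n : ℕ) :
    1 + algebraMap A K (Dk (n + 2)) * aSeq K (n + 1) =
      aSeq K (n + 2) * algebraMap A K (Dk (n + 2)) *
        (1 + ∑ j ∈ Finset.Icc 2 (n + 2), algebraMap A K (Dk j) ^ 2 ^ (n + 2 - j)) := by
  have := charP_fractionField K
  have h := congrArg (eval (algebraMap A K (tk (n + 2)))) (coeffPoly_add_eq_zero (K := K) n)
  simp only [eval_add, eval_mul, eval_pow, eval_C, eval_coeffPoly, eval_zero,
    drinfeld_tk (K := K) (show 2 ≤ n + 2 by omega), eval_map_algebraMap, aeval_algebraMap_apply,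
    coe_aeval_eq_eval] at h
  rw [← Dk] at h
  have hs := congrArg (algebraMap A K) (eCoeff_succ n)
  simp only [eCoeff, map_add, map_pow, map_one, map_sum] at hs
  rw [← hs, ← CharTwo.add_eq_zero]
  linear_combination h

lemma aSeq_two_mul_Dk : aSeq K 2 * algebraMap A K (Dk 2) = 1 := by
  have := charP_fractionField K
  have hb : algebraMap A K (brX 2) ≠ 0 := algebraMap_brX_ne_zero (by omega)
  have e : Dk 2 = brX 1 := by simp [Dk, ePoly_two, tk, brX]
  have e2 : brX 2 = brX 1 ^ 2 + brX 1 := by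
    simp only [brX, CharTwo.add_sq]
    linear_combination - aX ^ 2 * CharTwo.two_eq_zero (R := A)
  rw [e, aSeq, div_mul_eq_mul_div, div_eq_one_iff_eq hb, e2]
  simp only [aSeq, map_add, map_pow]
  ring

end Recursion

variable (K)

/-- The sequence `(a_j)` consists of nonzero elements of `K`, and setting
`d_j := a_j⁻¹`: (1) `d₂ = D₂`; (2) for every `k ≥ 3`,
`d_k·(d_{k-1} + D_k) = D_k·d_{k-1}·(1 + D_k + D_{k-1}² + ⋯ + D₂^{2^{k-2}})`,
i.e. `d_k·(d_{k-1} + D_k) = D_k·d_{k-1}·(1 + Σ_{j=2}^{k} D_j^{2^{k-j}})`. -/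
theorem stmt16 [IsFractionRing A K] :
    (∀ j : ℕ, aSeq K j ≠ 0) ∧
    (aSeq K 2)⁻¹ = algebraMap A K (Dk 2) ∧
    (∀ k : ℕ, 3 ≤ k →
      (aSeq K k)⁻¹ * ((aSeq K (k - 1))⁻¹ + algebraMap A K (Dk k)) =
        algebraMap A K (Dk k) * (aSeq K (k - 1))⁻¹ *
          (1 + ∑ j ∈ Finset.Icc 2 k, (algebraMap A K (Dk j)) ^ 2 ^ (k - j))) := by
  refine ⟨aSeq_ne_zero, inv_eq_of_mul_eq_one_right aSeq_two_mul_Dk, fun k hk => ?_⟩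
  obtain ⟨n, rfl⟩ : ∃ n, k = n + 2 := ⟨k - 2, by omega⟩
  have h := one_add_Dk_mul_aSeq (K := K) n
  have h1 := aSeq_ne_zero (K := K) (n + 1)
  have h2 := aSeq_ne_zero (K := K) (n + 2)
  rw [show n + 2 - 1 = n + 1 by omega]
  field_simp
  linear_combination h
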